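/- For all integers m, n, t > 0 the following identity of integers holds: (mn+1) · |D(m,n,t)| = (mt+1) · C((m+1)n − t, n − t). -/

import Mathlib

/-- A step of a lattice path: north `(0,1)`, east `(1,0)` or diagonal `(1,1)`. -/
inductive Step : Type
  | N : Step
  | E : Step
  | D : Step
  deriving DecidableEq

/-- The displacement vector of a step. -/
def stepVec : Step → ℤ × ℤ
  | .N => (0, 1)
  | .E => (1, 0)
  | .D => (1, 1)

/-- The lattice point reached after the first `k` steps of the path `P` (starting at the
origin). -/
def pt (P : List Step) (k : ℕ) : ℤ × ℤ := ((P.take k).map stepVec).sum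

/-- The path `P` starts with at least `t` north steps. -/
def StartsNorth (t : ℤ) (P : List Step) : Prop := List.replicate t.toNat Step.N <+: P

/-- The path `P` stays weakly above the line `x = m·y`. -/
def AboveLine (m : ℤ) (P : List Step) : Prop := ∀ k : ℕ, (pt P k).1 ≤ m * (pt P k).2

/-- An `(m,t)`-Schröder path of height `n`: a lattice path from `(0,0)` to `(mn,n)` using
north, east and diagonal steps, starting with at least `t` north steps and never going
below the line `x = m·y`. -/
def IsSchroeder (m n t : ℤ) (P : List Step) : Prop :=
  StartsNorth t P ∧ pt P P.length = (m * n, n) ∧ AboveLine m P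

/-- An `(m,t)`-Dyck path of height `n`: an `(m,t)`-Schröder path of height `n` with no
diagonal steps. -/
def IsDyck (m n t : ℤ) (P : List Step) : Prop :=
  IsSchroeder m n t P ∧ ∀ s ∈ P, s ≠ Step.D

/-- A Schröder path is small if none of its diagonal steps starts on the line `x = m·y`. -/
def IsSmall (m : ℤ) (P : List Step) : Prop :=
  ∀ j : ℕ, P[j]? = some Step.D → (pt P j).1 ≠ m * (pt P j).2

/-- A Schröder path is positive if it touches the line `x = m·y` only at its two
endpoints. -/
def IsPositive (m : ℤ) (P : List Step) : Prop :=
  ∀ k : ℕ, 0 < k → k < P.length → (pt P k).1 ≠ m * (pt P k).2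

/-- The set of indices `j` such that the `j`-th step of `P` is east and the `(j+1)`-st is
north; the corresponding valley point is `pt P (j+1)`. -/
def valleys (P : List Step) : Finset ℕ :=
  (Finset.range P.length).filter fun j => P[j]? = some Step.E ∧ P[j + 1]? = some Step.N

/-- The number of valleys of `P`. -/
def val (P : List Step) : ℕ := (valleys P).card

/-- The number of valleys of `P` whose `x`-coordinate is congruent to `i` modulo `m`. -/
def ival (m i : ℤ) (P : List Step) : ℕ :=
  ((valleys P).filter fun j => (pt P (j + 1)).1 % m = i % m).card

/-- The set of returns of `P`: valleys of the form `(m·i, i)`. -/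
def returns (m : ℤ) (P : List Step) : Finset ℕ :=
  (valleys P).filter fun j => (pt P (j + 1)).1 = m * (pt P (j + 1)).2

/-- The number of returns of `P`. -/
def ret (m : ℤ) (P : List Step) : ℕ := (returns m P).card

/-- The set of indices of diagonal steps of `P`. -/
def diags (P : List Step) : Finset ℕ :=
  (Finset.range P.length).filter fun j => P[j]? = some Step.D

/-- The number of diagonal steps of `P`. -/
def dg (P : List Step) : ℕ := (diags P).card

/-- A Schröder path is `m`-divisible if every diagonal step ends at an `x`-coordinate
divisible by `m`. -/
def MDivisible (m : ℤ) (P : List Step) : Prop :=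
  ∀ j ∈ diags P, m ∣ (pt P (j + 1)).1

/-- The number of cornered diagonal steps of `P`: diagonal steps connecting `(i·m − 1, i)`
to `(i·m, i + 1)` for some `i`. -/
def cd (m : ℤ) (P : List Step) : ℕ :=
  ((diags P).filter fun j => (pt P (j + 1)).1 = m * ((pt P (j + 1)).2 - 1)).card

/-- The generalized binomial coefficient `C(p,q) = p(p−1)⋯(p−q+1)/q!` for integers `p` and
`q ≥ 0`, and `C(p,q) = 0` for `q < 0`. -/
def C (p q : ℤ) : ℤ :=
  if q < 0 then 0
  else if 0 ≤ p then (p.toNat.choose q.toNat : ℤ)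
  else (-1) ^ q.toNat * ((q - p - 1).toNat.choose q.toNat : ℤ)

/-- The lists of north and east steps with displacement `(x, y)` which, when translated so as to
end on the line `X = m·Y`, stay weakly above that line. -/
def dyckTails (m x y : ℤ) : Set (List Step) :=
  {L | (∀ a ∈ L, a ≠ Step.D) ∧ pt L L.length = (x, y) ∧
    ∀ k : ℕ, (pt L k).1 - m * (pt L k).2 ≤ x - m * y}

theorem pt_zero (L : List Step) : pt L 0 = 0 := by simp [pt]

theorem pt_cons_succ (a : Step) (L : List Step) (k : ℕ) :
    pt (a :: L) (k + 1) = stepVec a + pt L k := by simp [pt]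

theorem pt_replicate_north_append (t : ℕ) (L : List Step) (k : ℕ) :
    pt (List.replicate t Step.N ++ L) k = (0, ((min k t : ℕ) : ℤ)) + pt L (k - t) := by
  simp [pt, List.take_append, List.take_replicate, stepVec]

theorem pt_snd_nonneg (L : List Step) (k : ℕ) : 0 ≤ (pt L k).2 := by
  induction L generalizing k with
  | nil => simp [pt]
  | cons a L ih =>
    cases k with
    | zero => simp [pt_zero]
    | succ k =>
      have h := ih k
      rw [pt_cons_succ]
      cases a <;> simp [stepVec] <;> omega

theorem pt_fst_nonneg (L : List Step) (k : ℕ) : 0 ≤ (pt L k).1 := by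
  induction L generalizing k with
  | nil => simp [pt]
  | cons a L ih =>
    cases k with
    | zero => simp [pt_zero]
    | succ k =>
      have h := ih k
      rw [pt_cons_succ]
      cases a <;> simp [stepVec] <;> omega

theorem dyckTails_of_neg_fst {m x y : ℤ} (h : x < 0) : dyckTails m x y = ∅ := by
  ext L
  simp only [Set.mem_empty_iff_false, iff_false]
  rintro ⟨-, h2, -⟩
  have := pt_fst_nonneg L L.length
  rw [h2] at this
  simp only at this
  omega

theorem dyckTails_of_neg_snd {m x y : ℤ} (h : y < 0) : dyckTails m x y = ∅ := by
  ext L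
  simp only [Set.mem_empty_iff_false, iff_false]
  rintro ⟨-, h2, -⟩
  have := pt_snd_nonneg L L.length
  rw [h2] at this
  simp only at this
  omega

theorem dyckTails_of_lt {m x y : ℤ} (h : x < m * y) : dyckTails m x y = ∅ := by
  ext L
  simp only [Set.mem_empty_iff_false, iff_false]
  rintro ⟨-, -, h3⟩
  have := h3 0
  simp [pt_zero] at this
  omega

theorem nil_mem_dyckTails {m x y : ℤ} : [] ∈ dyckTails m x y ↔ x = 0 ∧ y = 0 := by
  constructor
  · rintro ⟨-, h, -⟩
    simp [pt, Prod.ext_iff] at h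
    omega
  · rintro ⟨rfl, rfl⟩
    simp [dyckTails, pt, Prod.ext_iff]

theorem cons_mem_dyckTails {m x y : ℤ} (h : m * y ≤ x) (a : Step) (L : List Step) :
    a :: L ∈ dyckTails m x y ↔
      a ≠ Step.D ∧ L ∈ dyckTails m (x - (stepVec a).1) (y - (stepVec a).2) := by
  simp only [dyckTails, Set.mem_ofPred_eq, List.forall_mem_cons, List.length_cons, pt_cons_succ,
    Prod.ext_iff, Prod.fst_add, Prod.snd_add, and_assoc]
  refine and_congr_right fun _ => and_congr_right fun _ => ?_
  constructor
  · rintro ⟨h1, h2, h3⟩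
    refine ⟨by linarith, by linarith, fun k => ?_⟩
    have := h3 (k + 1)
    simp only [pt_cons_succ, Prod.fst_add, Prod.snd_add] at this
    linarith
  · rintro ⟨h1, h2, h3⟩
    refine ⟨by linarith, by linarith, fun k => ?_⟩
    cases k with
    | zero => simp [pt_zero, h]
    | succ k =>
      have := h3 k
      simp only [pt_cons_succ, Prod.fst_add, Prod.snd_add]
      linarith

theorem dyckTails_zero_zero (m : ℤ) : dyckTails m 0 0 = {[]} := by
  ext L
  cases L with
  | nil => simp [nil_mem_dyckTails]
  | cons a L =>
    rw [cons_mem_dyckTails (by simp)]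
    cases a <;> simp [stepVec, dyckTails_of_neg_fst, dyckTails_of_neg_snd]

theorem dyckTails_eq_union {m x y : ℤ} (h : m * y ≤ x) (h0 : ¬(x = 0 ∧ y = 0)) :
    dyckTails m x y =
      List.cons Step.N '' dyckTails m x (y - 1) ∪ List.cons Step.E '' dyckTails m (x - 1) y := by
  ext L
  cases L with
  | nil => simp [nil_mem_dyckTails, h0]
  | cons a L =>
    rw [cons_mem_dyckTails h]
    cases a <;> simp [stepVec]

theorem finite_dyckTails_and_ncard_eq_add {m x y : ℤ} (h : m * y ≤ x) (h0 : ¬(x = 0 ∧ y = 0))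
    (hN : (dyckTails m x (y - 1)).Finite) (hE : (dyckTails m (x - 1) y).Finite) :
    (dyckTails m x y).Finite ∧ (dyckTails m x y).ncard =
      (dyckTails m x (y - 1)).ncard + (dyckTails m (x - 1) y).ncard := by
  rw [dyckTails_eq_union h h0]
  refine ⟨(hN.image _).union (hE.image _), ?_⟩
  rw [Set.ncard_union_eq _ (hN.image _) (hE.image _),
    Set.ncard_image_of_injective _ List.cons_injective,
    Set.ncard_image_of_injective _ List.cons_injective]
  rw [Set.disjoint_left]
  rintro _ ⟨L, -, rfl⟩ ⟨L', -, h'⟩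
  simp at h'

/-- The ballot formula for paths with `b` north and `e` east steps below slope `1 / m`. -/
theorem finite_dyckTails_and_ncard {m : ℤ} (hm : 0 < m) (e b : ℕ) (h : m * b ≤ e + 1) :
    (dyckTails m e b).Finite ∧
      ((e : ℤ) + 1) * (dyckTails m e b).ncard = (e + 1 - m * b) * ((e + b).choose b : ℤ) := by
  induction hs : e + b generalizing e b with
  | zero =>
    obtain ⟨rfl, rfl⟩ : e = 0 ∧ b = 0 := by omega
    simp [dyckTails_zero_zero]
  | succ s ih =>
    rcases h.eq_or_lt with h' | h'
    · rw [dyckTails_of_lt (by omega)]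
      simp [h']
    have hle : m * b ≤ (e : ℤ) := by omega
    cases e with
    | zero =>
      have : (0 : ℤ) < b := by omega
      have := mul_pos hm this
      omega
    | succ e =>
      have hE := ih e b (by push_cast at hle; omega) (by omega)
      have ex : ((e + 1 : ℕ) : ℤ) - 1 = e := by simp
      cases b with
      | zero =>
        have hN : dyckTails m (e + 1 : ℕ) ((0 : ℕ) - 1) = ∅ := dyckTails_of_neg_snd (by simp)
        obtain ⟨hf, hc⟩ := finite_dyckTails_and_ncard_eq_add hle (by simp; omega)
          (by rw [hN]; exact Set.finite_empty) (by rw [ex]; exact hE.1)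
        refine ⟨hf, ?_⟩
        rw [hc, hN, ex]
        have := hE.2
        simp only [Nat.choose_zero_right, Nat.cast_zero, mul_zero, sub_zero] at this
        have h1 := mul_left_cancel₀ (by positivity) this
        simp [h1]
      | succ b =>
        have hN := ih (e + 1) b (by push_cast at hle ⊢; linarith) (by omega)
        have ey : ((b + 1 : ℕ) : ℤ) - 1 = b := by simp
        obtain ⟨hf, hc⟩ := finite_dyckTails_and_ncard_eq_add hle (by simp; omega)
          (by rw [ey]; exact hN.1) (by rw [ex]; exact hE.1)
        refine ⟨hf, ?_⟩
        rw [hc, ey, ex]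
        obtain rfl : s = e + (b + 1) := by omega
        have hp := Nat.choose_succ_succ (e + (b + 1)) b
        have ha := Nat.choose_succ_right_eq (e + (b + 1)) b
        rw [show e + (b + 1) - b = e + 1 by omega] at ha
        rw [Nat.succ_eq_add_one, Nat.succ_eq_add_one] at hp
        zify at hp ha
        rw [hp]
        have h1 := hN.2
        have h2 := hE.2
        push_cast at h1 h2 ha ⊢
        refine mul_left_cancel₀ (show ((e : ℤ) + 1) ≠ 0 by positivity) ?_
        linear_combination ((e : ℤ) + 1) * h1 + ((e : ℤ) + 2) * h2 - m * ha

theorem setOf_isDyck_eq_image {m n t : ℤ} (hm : 0 < m) (ht : 0 ≤ t) :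
    {P : List Step | IsDyck m n t P} =
      (List.replicate t.toNat Step.N ++ ·) '' dyckTails m (m * n) (n - t) := by
  obtain ⟨t, rfl⟩ := Int.eq_ofNat_of_zero_le ht
  ext P
  simp only [IsDyck, IsSchroeder, StartsNorth, AboveLine, Set.mem_ofPred_eq, Set.mem_image,
    Int.toNat_natCast]
  constructor
  · rintro ⟨⟨⟨L, rfl⟩, h2, h3⟩, h4⟩
    refine ⟨L, ⟨fun a ha => h4 a (by simp [ha]), ?_, fun k => ?_⟩, rfl⟩
    · simp [pt_replicate_north_append, Prod.ext_iff] at h2 ⊢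
      omega
    · have := h3 (t + k)
      simp [pt_replicate_north_append] at this
      linarith
  · rintro ⟨L, ⟨h1, h2, h3⟩, rfl⟩
    refine ⟨⟨⟨L, rfl⟩, ?_, fun k => ?_⟩, fun a ha => ?_⟩
    · simp [pt_replicate_north_append, h2]
    · rw [pt_replicate_north_append]
      rcases le_total k t with hk | hk
      · simp [Nat.sub_eq_zero_of_le hk, pt_zero, hk]
        positivity
      · have := h3 (k - t)
        simp [hk]
        linarith
    · rcases List.mem_append.1 ha with h | h
      · rw [List.eq_of_mem_replicate h]
        simp
      · exact h1 a h

/-- `(mn+1)·|D(m,n,t)| = (mt+1)·C((m+1)n−t, n−t)`. -/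
theorem statement0 (m n t : ℤ) (hm : 0 < m) (hn : 0 < n) (ht : 0 < t) :
    (m * n + 1) * (({P : List Step | IsDyck m n t P}.ncard : ℤ))
      = (m * t + 1) * C ((m + 1) * n - t) (n - t) := by
  rw [setOf_isDyck_eq_image hm ht.le, Set.ncard_image_of_injective _ (List.append_right_injective _)]
  rcases lt_or_ge n t with h | h
  · rw [dyckTails_of_neg_snd (by omega), C, if_pos (by omega)]
    simp
  · have hp : 0 < m * n := mul_pos hm hn
    have hq : (0 : ℤ) ≤ m * t := by positivity
    obtain ⟨e, he⟩ := Int.eq_ofNat_of_zero_le hp.le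
    obtain ⟨b, hb⟩ := Int.eq_ofNat_of_zero_le (sub_nonneg.2 h)
    have hmb : m * b = e - m * t := by rw [← hb, ← he]; ring
    have hsum : (m + 1) * n - t = ((e + b : ℕ) : ℤ) := by push_cast; rw [← hb, ← he]; ring
    rw [hsum, hb, he, C, if_neg (by omega), if_pos (by omega), Int.toNat_natCast, Int.toNat_natCast,
      (finite_dyckTails_and_ncard hm e b (by omega)).2, hmb]
    ring
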